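/- arXiv:2103.14446 — 2 statements merged into one kernel-verified Lean document; each statement's English description precedes it below -/
import Mathlib

section
/- Let B be an atomless Boolean contact algebra satisfying (DV6), (DV7), (C5) and the countable chain condition. Then a subset Q of B is a G-representative if and only if it is a W-representative. -/
variable {B : Type*} [BooleanAlgebra B]

/-- A Boolean contact algebra structure on a Boolean algebra `B`. -/
structure BCA (B : Type*) [BooleanAlgebra B] where
  C : B → B → Prop
  c0 : ∀ x : B, ¬ C ⊥ x
  c1 : ∀ x y : B, x ≠ ⊥ → x ≤ y → C x y
  c2 : ∀ x y : B, C x y → C y x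
  c3 : ∀ x y z : B, x ≤ y → C z x → C z y
  c4 : ∀ x y z : B, C x (y ⊔ z) → C x y ∨ C x z

namespace BCA

/-- The well-inside relation: `x ≪ y` iff `¬ (x C yᶜ)`. -/
def wi (A : BCA B) (x y : B) : Prop := ¬ A.C x yᶜ

/-- `Q₁` covers `Q₂` iff every element of `Q₁` contains some element of `Q₂`. -/
def Covers (Q₁ Q₂ : Set B) : Prop := ∀ x ∈ Q₁, ∃ y ∈ Q₂, y ≤ x

/-- A Grzegorczyk representative of a point. -/
def IsGRep (A : BCA B) (Q : Set B) : Prop :=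
  Q.Nonempty ∧ (⊥ : B) ∉ Q ∧
    (∀ u ∈ Q, ∀ v ∈ Q, u = v ∨ A.wi u v ∨ A.wi v u) ∧
    (∀ u ∈ Q, ∃ v ∈ Q, A.wi v u) ∧
    (∀ x y : B, (∀ u ∈ Q, u ⊓ x ≠ ⊥ ∧ u ⊓ y ≠ ⊥) → A.C x y)

/-- An abstractive set. -/
def IsAbstractive (A : BCA B) (S : Set B) : Prop :=
  S.Nonempty ∧ (⊥ : B) ∉ S ∧
    (∀ u ∈ S, ∀ v ∈ S, u = v ∨ A.wi u v ∨ A.wi v u) ∧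
    ¬ ∃ x ∈ S, ∀ y ∈ S, x ≤ y

/-- A Whitehead representative of a point. -/
def IsWRep (A : BCA B) (S : Set B) : Prop :=
  A.IsAbstractive S ∧ ∀ T : Set B, A.IsAbstractive T → Covers S T → Covers T S

/-- An ω-abstractive set: an abstractive set mutually covering with a countable abstractive set. -/
def IsOmegaAbstractive (A : BCA B) (S : Set B) : Prop :=
  A.IsAbstractive S ∧
    ∃ T : Set B, T.Countable ∧ A.IsAbstractive T ∧ Covers S T ∧ Covers T S

/-- A filter of the Boolean algebra `B`. -/
def IsFilter (F : Set B) : Prop :=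
  F.Nonempty ∧ (⊥ : B) ∉ F ∧
    (∀ x ∈ F, ∀ y : B, x ≤ y → y ∈ F) ∧
    (∀ x ∈ F, ∀ y ∈ F, x ⊓ y ∈ F)

/-- A round filter. -/
def IsRoundFilter (A : BCA B) (F : Set B) : Prop :=
  IsFilter F ∧ ∀ x ∈ F, ∃ y ∈ F, A.wi y x

/-- A Grzegorczyk point: the filter generated by a G-representative. -/
def IsGPoint (A : BCA B) (G : Set B) : Prop :=
  ∃ Q : Set B, A.IsGRep Q ∧ G = {y : B | ∃ x ∈ Q, x ≤ y}

/-- Atomlessness of the Boolean algebra. -/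
def Atomless (B : Type*) [BooleanAlgebra B] : Prop :=
  ∀ x : B, x ≠ ⊥ → ∃ y : B, y ≠ ⊥ ∧ y < x

/-- The interpolation axiom (DV6). -/
def DV6 (A : BCA B) : Prop := ∀ x y : B, A.wi x y → ∃ z : B, A.wi x z ∧ A.wi z y

/-- The non-tangential part axiom (DV7). -/
def DV7 (A : BCA B) : Prop := ∀ x : B, x ≠ ⊥ → ∃ y : B, y ≠ ⊥ ∧ A.wi y x

/-- The connectedness axiom (C5). -/
def C5 (A : BCA B) : Prop := ∀ x : B, x ≠ ⊥ → x ≠ ⊤ → A.C x xᶜ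

/-- The countable chain condition for a Boolean algebra. -/
def CCC (B : Type*) [BooleanAlgebra B] : Prop :=
  ∀ S : Set B, (∀ x ∈ S, x ≠ ⊥) → (S.Pairwise fun x y => x ⊓ y = ⊥) → S.Countable

end BCA

namespace BCA

theorem wi_le (A : BCA B) {x y : B} (h : A.wi x y) : x ≤ y := by
  by_contra hxy
  have hne : x ⊓ yᶜ ≠ ⊥ := fun h0 => hxy (disjoint_compl_right_iff.1 (disjoint_iff.2 h0))
  exact h (A.c2 _ _ (A.c3 _ _ _ inf_le_left (A.c2 _ _ (A.c1 _ _ hne inf_le_right))))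

theorem wi_mono (A : BCA B) {x x' y y' : B} (hx : x' ≤ x) (hy : y ≤ y') (h : A.wi x y) :
    A.wi x' y' := fun hc =>
  h (A.c2 _ _ (A.c3 _ _ _ hx (A.c2 _ _ (A.c3 _ _ _ (compl_le_compl hy) hc))))

theorem wi_inf (A : BCA B) {a b c d : B} (h₁ : A.wi a b) (h₂ : A.wi c d) :
    A.wi (a ⊓ c) (b ⊓ d) := by
  intro hc
  rw [compl_inf] at hc
  rcases A.c4 _ _ _ hc with h | h
  · exact A.wi_mono inf_le_left le_rfl h₁ h
  · exact A.wi_mono inf_le_right le_rfl h₂ h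

theorem eq_bot_or_eq_top_of_wi_self {A : BCA B} (hc5 : A.C5) {x : B} (h : A.wi x x) :
    x = ⊥ ∨ x = ⊤ := by
  by_contra! hx
  exact h (hc5 x hx.1 hx.2)

theorem IsAbstractive.le_total {A : BCA B} {S : Set B} (hS : A.IsAbstractive S) {u v : B}
    (hu : u ∈ S) (hv : v ∈ S) : u ≤ v ∨ v ≤ u := by
  rcases hS.2.2.1 u hu v hv with h | h | h
  · exact Or.inl h.le
  · exact Or.inl (A.wi_le h)
  · exact Or.inr (A.wi_le h)

theorem IsAbstractive.exists_wi {A : BCA B} {S : Set B} (hS : A.IsAbstractive S) {u : B}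
    (hu : u ∈ S) : ∃ v ∈ S, A.wi v u ∧ v < u := by
  by_contra! hn
  refine hS.2.2.2 ⟨u, hu, fun v hv => ?_⟩
  rcases hS.2.2.1 u hu v hv with h | h | h
  · exact h.le
  · exact A.wi_le h
  · by_contra hle
    exact hn v hv h ((A.wi_le h).lt_of_not_ge hle)

theorem IsGRep.isAbstractive {A : BCA B} (hat : Atomless B) (hdv7 : A.DV7) (hc5 : A.C5)
    {Q : Set B} (hQ : A.IsGRep Q) : A.IsAbstractive Q := by
  obtain ⟨hne, hbot, hlin, hwi, hcon⟩ := hQ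
  refine ⟨hne, hbot, hlin, ?_⟩
  rintro ⟨x, hx, hmin⟩
  obtain ⟨v, hv, hvx⟩ := hwi x hx
  rcases eq_bot_or_eq_top_of_wi_self hc5 (A.wi_mono (hmin v hv) le_rfl hvx) with rfl | rfl
  · exact hbot hx
  obtain ⟨y, hy, hyt⟩ := hat ⊤ fun h => hbot (h ▸ hx)
  obtain ⟨z, hz, hzy⟩ := hdv7 y hy
  refine hzy (hcon z yᶜ fun u hu => ?_)
  obtain rfl := top_le_iff.1 (hmin u hu)
  simpa using ⟨hz, hyt.ne⟩

theorem IsGRep.isWRep {A : BCA B} (hat : Atomless B) (hdv7 : A.DV7) (hc5 : A.C5)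
    {Q : Set B} (hQ : A.IsGRep Q) : A.IsWRep Q := by
  refine ⟨hQ.isAbstractive hat hdv7 hc5, fun T hT hQT t ht => ?_⟩
  obtain ⟨s, hs, hst, -⟩ := hT.exists_wi ht
  by_contra! hn
  refine hst (hQ.2.2.2.2 s tᶜ fun u hu => ⟨fun h => ?_, fun h => ?_⟩)
  · obtain ⟨y, hy, hyu⟩ := hQT u hu
    rcases hT.le_total hy hs with hys | hsy
    · exact hT.2.1 (le_bot_iff.1 (h ▸ le_inf hyu hys) ▸ hy)
    · exact hT.2.1 (le_bot_iff.1 (h ▸ le_inf (hsy.trans hyu) le_rfl) ▸ hs)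
  · exact hn u hu (disjoint_compl_right_iff.1 (disjoint_iff.2 h))

/-- Under the countable chain condition every abstractive set has a countable coinitial subset. -/
theorem IsAbstractive.exists_countable_coinitial {A : BCA B} (hccc : CCC B) {Q : Set B}
    (hQ : A.IsAbstractive Q) : ∃ D ⊆ Q, D.Countable ∧ ∀ q ∈ Q, ∃ d ∈ D, d ≤ q := by
  let E : Set B := {e | ∃ a ∈ Q, ∃ b ∈ Q, b < a ∧ a \ b = e}
  obtain ⟨F, hF⟩ := zorn_subset {F : Set B | F ⊆ E ∧ F.Pairwise fun x y => x ⊓ y = ⊥} (by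
    intro c hc hchain
    exact ⟨⋃₀ c, ⟨Set.sUnion_subset fun s hs => (hc hs).1,
      (Set.pairwise_sUnion hchain.directedOn).2 fun s hs => (hc hs).2⟩,
      fun s hs => Set.subset_sUnion_of_mem hs⟩)
  have hE : ∀ e ∈ E, e ≠ ⊥ := by
    rintro _ ⟨a, -, b, -, hba, rfl⟩ h
    exact hba.not_ge (sdiff_eq_bot_iff.1 h)
  have hFc : F.Countable := hccc F (fun e he => hE e (hF.prop.1 he)) hF.prop.2
  have hchoice : ∀ e : F, ∃ b ∈ Q, ∃ a, a \ b = e := fun e => by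
    obtain ⟨a, -, b, hb, -, h⟩ := hF.prop.1 e.2
    exact ⟨b, hb, a, h⟩
  choose b hbQ a hab using hchoice
  have := hFc.to_subtype
  refine ⟨Set.range b, Set.range_subset_iff.2 hbQ, Set.countable_range b, fun q hq => ?_⟩
  by_contra! hn
  have hqb : ∀ e : F, q ≤ b e := fun e =>
    (hQ.le_total hq (hbQ e)).resolve_right (hn _ ⟨e, rfl⟩)
  obtain ⟨p, hp, -, hpq⟩ := hQ.exists_wi hq
  have hmem : q \ p ∈ E := ⟨q, hq, p, hp, hpq, rfl⟩
  have hdisj : ∀ e ∈ F, Disjoint (q \ p) e := fun e he => by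
    have h : Disjoint (b ⟨e, he⟩) e := by
      have := disjoint_sdiff_self_right (x := b ⟨e, he⟩) (y := a ⟨e, he⟩)
      rwa [hab] at this
    exact h.mono_left (sdiff_le.trans (hqb _))
  have hins : insert (q \ p) F ⊆ F := hF.le_of_ge
    ⟨Set.insert_subset hmem hF.prop.1, hF.prop.2.insert fun e he _ =>
      ⟨(hdisj e he).eq_bot, (hdisj e he).symm.eq_bot⟩⟩ (Set.subset_insert _ _)
  exact hE _ hmem (disjoint_self.1 (hdisj _ (hins (Set.mem_insert _ _))))

/-- Under the countable chain condition every abstractive set has a coinitial sequence that is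
decreasing for the well-inside relation. -/
theorem IsAbstractive.exists_seq {A : BCA B} (hccc : CCC B) {Q : Set B}
    (hQ : A.IsAbstractive Q) :
    ∃ u : ℕ → B, (∀ n, u n ∈ Q) ∧ (∀ n, A.wi (u (n + 1)) (u n)) ∧ ∀ q ∈ Q, ∃ n, u n ≤ q := by
  obtain ⟨D, hDQ, hDc, hD⟩ := hQ.exists_countable_coinitial hccc
  obtain ⟨q₀, hq₀⟩ := hQ.1
  obtain ⟨d₀, hd₀, -⟩ := hD q₀ hq₀
  obtain ⟨d, rfl⟩ := hDc.exists_eq_range ⟨d₀, hd₀⟩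
  have hstep : ∀ (n : ℕ) (x : Q), ∃ y : Q, A.wi y x ∧ (y : B) ≤ d n := fun n x => by
    have hdn : d n ∈ Q := hDQ ⟨n, rfl⟩
    rcases hQ.le_total x.2 hdn with h | h
    · obtain ⟨y, hy, hyx, -⟩ := hQ.exists_wi x.2
      exact ⟨⟨y, hy⟩, hyx, (A.wi_le hyx).trans h⟩
    · obtain ⟨y, hy, hyd, -⟩ := hQ.exists_wi hdn
      exact ⟨⟨y, hy⟩, A.wi_mono le_rfl h hyd, A.wi_le hyd⟩
  choose f hfwi hfle using hstep
  let u : ℕ → Q := fun n => Nat.rec ⟨q₀, hq₀⟩ f n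
  refine ⟨Subtype.val ∘ u, fun n => (u n).2, fun n => hfwi n (u n), fun q hq => ?_⟩
  obtain ⟨_, ⟨n, rfl⟩, hn⟩ := hD q hq
  exact ⟨n + 1, (hfle n (u n)).trans hn⟩

theorem DV6.exists_seq {A : BCA B} (hdv6 : A.DV6) {x y : B} (hxy : A.wi x y) :
    ∃ w : ℕ → B, w 0 = y ∧ (∀ n, A.wi x (w n)) ∧ ∀ n, A.wi (w (n + 1)) (w n) := by
  have hstep : ∀ z : {z // A.wi x z}, ∃ z' : {z // A.wi x z}, A.wi (z' : B) z := fun z => by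
    obtain ⟨z', h₁, h₂⟩ := hdv6 x z z.2
    exact ⟨⟨z', h₁⟩, h₂⟩
  choose f hf using hstep
  let w : ℕ → {z // A.wi x z} := fun n => Nat.rec ⟨y, hxy⟩ (fun _ => f) n
  exact ⟨Subtype.val ∘ w, rfl, fun n => (w n).2, fun n => hf (w n)⟩

theorem isAbstractive_range {A : BCA B} (hc5 : A.C5) {s : ℕ → B} (hbot : ∀ n, s n ≠ ⊥)
    (htop : ∀ n, s n ≠ ⊤) (hs : ∀ n, A.wi (s (n + 1)) (s n)) :
    A.IsAbstractive (Set.range s) := by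
  have hanti : Antitone s := antitone_nat_of_succ_le fun n => A.wi_le (hs n)
  have hwi : ∀ m n, m < n → A.wi (s n) (s m) := fun m n h =>
    A.wi_mono (hanti h) le_rfl (hs m)
  refine ⟨Set.range_nonempty s, ?_, ?_, ?_⟩
  · rintro ⟨n, hn⟩
    exact hbot n hn
  · rintro _ ⟨m, rfl⟩ _ ⟨n, rfl⟩
    rcases lt_trichotomy m n with h | rfl | h
    · exact Or.inr (Or.inr (hwi _ _ h))
    · exact Or.inl rfl
    · exact Or.inr (Or.inl (hwi _ _ h))
  · rintro ⟨_, ⟨n, rfl⟩, hmin⟩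
    rcases eq_bot_or_eq_top_of_wi_self hc5
      (A.wi_mono (hmin _ ⟨n + 1, rfl⟩) le_rfl (hs n)) with h | h
    · exact hbot n h
    · exact htop n h

theorem IsWRep.isGRep {A : BCA B} (hdv6 : A.DV6) (hc5 : A.C5) (hccc : CCC B)
    {Q : Set B} (hQ : A.IsWRep Q) : A.IsGRep Q := by
  obtain ⟨habs, hmin⟩ := hQ
  refine ⟨habs.1, habs.2.1, habs.2.2.1, fun u hu => ?_, fun x y hxy => ?_⟩
  · obtain ⟨v, hv, hvu, -⟩ := habs.exists_wi hu
    exact ⟨v, hv, hvu⟩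
  by_contra hC
  obtain ⟨u, huQ, hu, hcoin⟩ := habs.exists_seq hccc
  have hwi : A.wi x yᶜ := by rwa [wi, compl_compl]
  obtain ⟨w, hw0, hxw, hw⟩ := hdv6.exists_seq hwi
  have hw_le : ∀ n, w n ≤ yᶜ := fun n =>
    hw0 ▸ antitone_nat_of_succ_le (fun n => A.wi_le (hw n)) n.zero_le
  have hy : ∀ q ∈ Q, ¬ q ≤ yᶜ := fun q hq h =>
    (hxy q hq).2 (le_compl_iff_disjoint_right.1 h).eq_bot
  have hT : A.IsAbstractive (Set.range fun n => w n ⊓ u n) := by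
    refine isAbstractive_range hc5 (fun n h => (hxy _ (huQ n)).1 ?_) (fun n h => ?_)
      fun n => A.wi_inf (hw n) (hu n)
    · rw [inf_comm]
      exact le_bot_iff.1 ((inf_le_inf_right _ (A.wi_le (hxw n))).trans h.le)
    · exact hy _ (huQ n) (le_top.trans (h.ge.trans (inf_le_left.trans (hw_le n))))
  obtain ⟨q, hq, hq_le⟩ := hmin _ hT (fun q hq => by
    obtain ⟨n, hn⟩ := hcoin q hq
    exact ⟨_, ⟨n, rfl⟩, inf_le_right.trans hn⟩) _ ⟨0, rfl⟩
  exact hy q hq (hq_le.trans (inf_le_left.trans (hw_le 0)))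

end BCA

theorem stmt_8 {B : Type*} [BooleanAlgebra B] (A : BCA B)
    (hat : BCA.Atomless B) (hdv6 : A.DV6) (hdv7 : A.DV7) (hc5 : A.C5)
    (hccc : BCA.CCC B) (Q : Set B) :
    A.IsGRep Q ↔ A.IsWRep Q :=
  ⟨fun h => h.isWRep hat hdv7 hc5, fun h => h.isGRep hdv6 hc5 hccc⟩
end

section
/- In a Boolean contact algebra, every G-point is a maximal round filter (an end): every G-point 𝒢 is a round filter, and for every round filter F with 𝒢 ⊆ F we have F = 𝒢. -/
variable {B : Type*} [BooleanAlgebra B]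

namespace BCA

theorem wi.le {A : BCA B} {x y : B} (h : A.wi x y) : x ≤ y := by
  rw [← disjoint_compl_right_iff, disjoint_iff]
  by_contra hne
  exact h (A.c2 _ _ (A.c3 _ _ _ inf_le_left (A.c2 _ _ (A.c1 _ _ hne inf_le_right))))

theorem wi.trans_le {A : BCA B} {x y z : B} (h : A.wi x y) (hyz : y ≤ z) : A.wi x z :=
  fun hc => h (A.c3 _ _ _ (compl_le_compl hyz) hc)

theorem IsGRep.isRoundFilter {A : BCA B} {Q : Set B} (hQ : A.IsGRep Q) :
    A.IsRoundFilter {y : B | ∃ x ∈ Q, x ≤ y} := by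
  obtain ⟨⟨q, hq⟩, hbot, hchain, hround, -⟩ := hQ
  refine ⟨⟨⟨q, q, hq, le_rfl⟩, ?_, ?_, ?_⟩, ?_⟩
  · rintro ⟨x, hx, hle⟩
    exact hbot (le_bot_iff.mp hle ▸ hx)
  · rintro x ⟨u, hu, hux⟩ y hxy
    exact ⟨u, hu, hux.trans hxy⟩
  · rintro x ⟨u, hu, hux⟩ y ⟨v, hv, hvy⟩
    rcases hchain u hu v hv with rfl | h | h
    · exact ⟨u, hu, le_inf hux hvy⟩
    · exact ⟨u, hu, le_inf hux (h.le.trans hvy)⟩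
    · exact ⟨v, hv, le_inf (h.le.trans hux) hvy⟩
  · rintro x ⟨u, hu, hux⟩
    obtain ⟨v, hv, hvu⟩ := hround u hu
    exact ⟨v, ⟨v, hv, le_rfl⟩, hvu.trans_le hux⟩

theorem IsGRep.exists_le_of_wi {A : BCA B} {Q F : Set B} (hQ : A.IsGRep Q)
    (hF : IsFilter F) (hQF : Q ⊆ F) {x y : B} (hy : y ∈ F) (hyx : A.wi y x) :
    ∃ u ∈ Q, u ≤ x := by
  by_contra! hcon
  refine hyx (hQ.2.2.2.2 _ _ fun u hu => ⟨fun h => ?_, fun h => hcon u hu ?_⟩)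
  · exact hF.2.1 (h ▸ hF.2.2.2 u (hQF hu) y hy)
  · exact disjoint_compl_right_iff.mp (disjoint_iff.mpr h)

end BCA

theorem stmt_12 {B : Type*} [BooleanAlgebra B] (A : BCA B) (G : Set B)
    (hG : A.IsGPoint G) :
    A.IsRoundFilter G ∧ ∀ F : Set B, A.IsRoundFilter F → G ⊆ F → F = G := by
  obtain ⟨Q, hQ, rfl⟩ := hG
  refine ⟨hQ.isRoundFilter, fun F hF hGF => Set.Subset.antisymm (fun x hx => ?_) hGF⟩
  obtain ⟨y, hy, hyx⟩ := hF.2 x hx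
  exact hQ.exists_le_of_wi hF.1 (fun u hu => hGF ⟨u, hu, le_rfl⟩) hy hyx
end
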